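/- arXiv:1812.04382 — 2 statements merged into one kernel-verified Lean document; each statement's English description precedes it below -/
import Mathlib

section
/- Let u = √3/2, let f₁ = z, f₂ = x²+y², f₃ = 11x⁶+15x⁴y²+45x²y⁴+9y⁶, and let Γ = (2093688/17)f₁¹² − (9398511/34)f₁¹⁰f₂ + (2995218/17)f₁⁸f₂² − (64485153/1088)f₁⁶f₂³ + (18708003/4352)f₁⁴f₂⁴ + (1258659/4352)f₁²f₂⁵ − (493695/4352)f₂⁶ + (2121309/1088)f₁⁶f₃ − (402561/4352)f₁⁴f₂f₃ − (158697/4352)f₁²f₂²f₃ + (2619/128)f₂³f₃ − (3979/4352)f₃², regarded as a homogeneous polynomial of degree 12 in ℂ[x,y,z]. Then Γ is irreducible in ℂ[x,y,z]; in particular the plane curve of degree 12 it defines is irreducible. -/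
open MvPolynomial

noncomputable section

/-- The polynomial ring `ℂ[x,y,z]`, with `x = X 0`, `y = X 1`, `z = X 2`. -/
abbrev PolyC := MvPolynomial (Fin 3) ℂ

/-- The invariant `f₁ = z`. -/
def f1 : PolyC := X 2

/-- The invariant `f₂ = x² + y²`. -/
def f2 : PolyC := X 0 ^ 2 + X 1 ^ 2

/-- The invariant `f₃ = 11x⁶ + 15x⁴y² + 45x²y⁴ + 9y⁶`. -/
def f3 : PolyC :=
  C 11 * X 0 ^ 6 + C 15 * X 0 ^ 4 * X 1 ^ 2 + C 45 * X 0 ^ 2 * X 1 ^ 4 + C 9 * X 1 ^ 6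

/-- The degree-12 form `Γ`, expressed in terms of the invariants `f₁`, `f₂`, `f₃`,
regarded as an element of `ℂ[x,y,z]`. -/
def Γpoly : PolyC :=
  C (2093688/17) * f1 ^ 12 - C (9398511/34) * f1 ^ 10 * f2 + C (2995218/17) * f1 ^ 8 * f2 ^ 2
    - C (64485153/1088) * f1 ^ 6 * f2 ^ 3 + C (18708003/4352) * f1 ^ 4 * f2 ^ 4
    + C (1258659/4352) * f1 ^ 2 * f2 ^ 5 - C (493695/4352) * f2 ^ 6
    + C (2121309/1088) * f1 ^ 6 * f3 - C (402561/4352) * f1 ^ 4 * f2 * f3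
    - C (158697/4352) * f1 ^ 2 * f2 ^ 2 * f3 + C (2619/128) * f2 ^ 3 * f3
    - C (3979/4352) * f3 ^ 2

end


/-- the sextic -/
noncomputable def kInt : Polynomial ℤ :=
  Polynomial.X ^ 6 + Polynomial.C 83310258 * Polynomial.X ^ 5
    + Polynomial.C 1970966500833024 * Polynomial.X ^ 4
    + Polynomial.C (-4534617972215283829056) * Polynomial.X ^ 3
    + Polynomial.C 14929811727470533610526564864 * Polynomial.X ^ 2
    + Polynomial.C 585527674384591551321095754721640448 * Polynomial.X
    + Polynomial.C (-11928444188369943590776271436536693314289664)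

theorem kInt_natDegree : kInt.natDegree = 6 := by
  unfold kInt; compute_degree!

theorem kInt_monic : kInt.Monic := by
  unfold kInt; monicity!

/-- reduction mod 7 -/
noncomputable def k7 : Polynomial (ZMod 7) :=
  Polynomial.X ^ 6 + Polynomial.C 3 * Polynomial.X ^ 5
    + Polynomial.C 2 * Polynomial.X ^ 4
    + Polynomial.C 2 * Polynomial.X ^ 3
    + Polynomial.C 4 * Polynomial.X ^ 2
    + Polynomial.C 1 * Polynomial.X
    + Polynomial.C 4

theorem kInt_map : kInt.map (Int.castRingHom (ZMod 7)) = k7 := by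
  unfold kInt k7
  simp only [Polynomial.map_add, Polynomial.map_mul, Polynomial.map_pow, Polynomial.map_X,
    Polynomial.map_C]
  have e1 : Int.castRingHom (ZMod 7) 83310258 = 3 := by decide +kernel
  have e2 : Int.castRingHom (ZMod 7) 1970966500833024 = 2 := by decide +kernel
  have e3 : Int.castRingHom (ZMod 7) (-4534617972215283829056) = 2 := by decide +kernel
  have e4 : Int.castRingHom (ZMod 7) 14929811727470533610526564864 = 4 := by decide +kernel
  have e5 : Int.castRingHom (ZMod 7) 585527674384591551321095754721640448 = 1 := by decide +kernel
  have e6 : Int.castRingHom (ZMod 7) (-11928444188369943590776271436536693314289664) = 4 := by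
    decide +kernel
  rw [e1, e2, e3, e4, e5, e6]

theorem k7_natDegree : k7.natDegree = 6 := by
  unfold k7; compute_degree!

theorem k7_monic : k7.Monic := by
  unfold k7; monicity!

instance : Fact (Nat.Prime 7) := ⟨by norm_num⟩

theorem k7_coeffs : k7.coeff 0 = 4 ∧ k7.coeff 1 = 1 ∧ k7.coeff 2 = 4 ∧ k7.coeff 3 = 2
    ∧ k7.coeff 4 = 2 ∧ k7.coeff 5 = 3 ∧ k7.coeff 6 = 1 := by
  unfold k7
  simp [Polynomial.coeff_X, Polynomial.coeff_C, Polynomial.coeff_X_pow]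

theorem dec1 : ∀ c : ZMod 7, c ^ 6 + 3 * c ^ 5 + 2 * c ^ 4 + 2 * c ^ 3 + 4 * c ^ 2 + c + 4 ≠ 0 := by
  decide +kernel

theorem dec2 : ∀ a b : ZMod 7, 
    ¬ (let d := 3 - a; let e := 2 - b - a * d; let f := 2 - a * e - b * d
       let g := 4 - a * f - b * e
       a * g + b * f = 1 ∧ b * g = 4) := by
  decide +kernel

theorem dec3 : ∀ a b c : ZMod 7, 
    ¬ (let d := 3 - a; let e := 2 - b - a * d; let f := 2 - a * e - b * d - c
       a * f + b * e + c * d = 4 ∧ b * f + c * e = 1 ∧ c * f = 4) := by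
  decide +kernel

theorem k7_irreducible : Irreducible k7 := by
  have h1 : k7 ≠ 1 := by
    intro h; have := k7_natDegree; rw [h] at this; simp at this
  rw [k7_monic.irreducible_iff_lt_natDegree_lt h1]
  rintro q hq hd ⟨r, hr⟩
  rw [k7_natDegree] at hd
  obtain ⟨c0, c1, c2, c3, c4, c5, c6⟩ := k7_coeffs
  have hrm : r.Monic := hq.of_mul_monic_left (hr ▸ k7_monic)
  have hdeg : q.natDegree + r.natDegree = 6 := by
    rw [← k7_natDegree, hr, hq.natDegree_mul hrm]
  have hqd : q.coeff q.natDegree = 1 := hq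
  have hrd : r.coeff r.natDegree = 1 := hrm
  have hq0 : ∀ n, q.natDegree < n → q.coeff n = 0 := fun n hn =>
    Polynomial.coeff_eq_zero_of_natDegree_lt hn
  have hr0 : ∀ n, r.natDegree < n → r.coeff n = 0 := fun n hn =>
    Polynomial.coeff_eq_zero_of_natDegree_lt hn
  rw [hr] at c0 c1 c2 c3 c4 c5 c6
  simp only [Polynomial.coeff_mul, Finset.Nat.antidiagonal_succ, Finset.Nat.antidiagonal_zero,
    Finset.map_singleton, Finset.sum_cons, Finset.sum_singleton, Finset.map_cons,
    Function.Embedding.prodMap, Function.Embedding.coeFn_mk, Prod.map, Nat.succ_eq_add_one,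
    Function.Embedding.refl_apply, Nat.reduceAdd, zero_add] at c0 c1 c2 c3 c4 c5 c6
  simp only [Finset.mem_Ioc] at hd
  obtain ⟨hd1, hd2⟩ := hd
  have hd3 : q.natDegree ≤ 3 := by omega
  generalize q.natDegree = n at *
  interval_cases n
  · have hm : r.natDegree = 5 := by omega
    rw [hm] at hrd hr0
    have := hq0 2 (by norm_num); have := hq0 3 (by norm_num); have := hq0 4 (by norm_num)
    have := hq0 5 (by norm_num); have := hq0 6 (by norm_num)
    have := hr0 6 (by norm_num)
    simp only [*, mul_zero, zero_mul, add_zero, zero_add, mul_one, one_mul] at c0 c1 c2 c3 c4 c5 c6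
    apply dec1 (- q.coeff 0)
    linear_combination (exp := 1) - c0 + q.coeff 0 * c1 - q.coeff 0 ^ 2 * c2 + q.coeff 0 ^ 3 * c3
      - q.coeff 0 ^ 4 * c4 + q.coeff 0 ^ 5 * c5
  · have hm : r.natDegree = 4 := by omega
    rw [hm] at hrd hr0
    have := hq0 3 (by norm_num); have := hq0 4 (by norm_num)
    have := hq0 5 (by norm_num); have := hq0 6 (by norm_num)
    have := hr0 5 (by norm_num)
    have := hr0 6 (by norm_num)
    simp only [*, mul_zero, zero_mul, add_zero, zero_add, mul_one, one_mul] at c0 c1 c2 c3 c4 c5 c6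
    apply dec2 (q.coeff 1) (q.coeff 0)
    have hD : r.coeff 3 = 3 - q.coeff 1 := by linear_combination c5
    have hE : r.coeff 2 = 2 - q.coeff 0 - q.coeff 1 * r.coeff 3 := by linear_combination c4
    have hF : r.coeff 1 = 2 - q.coeff 1 * r.coeff 2 - q.coeff 0 * r.coeff 3 := by
      linear_combination c3
    have hG : r.coeff 0 = 4 - q.coeff 1 * r.coeff 1 - q.coeff 0 * r.coeff 2 := by
      linear_combination c2
    simp only [← hD, ← hE, ← hF, ← hG]
    exact ⟨by linear_combination c1, c0⟩
  · have hm : r.natDegree = 3 := by omega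
    rw [hm] at hrd hr0
    have := hq0 4 (by norm_num)
    have := hq0 5 (by norm_num); have := hq0 6 (by norm_num)
    have := hr0 4 (by norm_num)
    have := hr0 5 (by norm_num)
    have := hr0 6 (by norm_num)
    simp only [*, mul_zero, zero_mul, add_zero, zero_add, mul_one, one_mul] at c0 c1 c2 c3 c4 c5 c6
    apply dec3 (q.coeff 2) (q.coeff 1) (q.coeff 0)
    have hD : r.coeff 2 = 3 - q.coeff 2 := by linear_combination c5
    have hE : r.coeff 1 = 2 - q.coeff 1 - q.coeff 2 * r.coeff 2 := by linear_combination c4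
    have hF : r.coeff 0 = 2 - q.coeff 2 * r.coeff 1 - q.coeff 1 * r.coeff 2 - q.coeff 0 := by
      linear_combination c3
    simp only [← hD, ← hE, ← hF]
    exact ⟨by linear_combination c2, by linear_combination c1, c0⟩

theorem kInt_irreducible : Irreducible kInt :=
  kInt_monic.irreducible_of_irreducible_map (Int.castRingHom (ZMod 7)) kInt
    (kInt_map ▸ k7_irreducible)

/-- over ℚ -/
noncomputable def kQ : Polynomial ℚ := kInt.map (algebraMap ℤ ℚ)

theorem kQ_irreducible : Irreducible kQ :=
  (kInt_monic.irreducible_iff_irreducible_map_fraction_map (K := ℚ)).1 kInt_irreducible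

theorem kQ_monic : kQ.Monic := kInt_monic.map _

theorem kQ_natDegree : kQ.natDegree = 6 := by
  rw [kQ, kInt_monic.natDegree_map, kInt_natDegree]

theorem kQ_coeff : kQ.coeff 0 < 0 := by
  rw [kQ, Polynomial.coeff_map]
  unfold kInt
  simp [Polynomial.coeff_X]

theorem norm_aux {K E : Type*} [Field K] [Field E] [Algebra K E] (x : E) (hint : IsIntegral K x)
    (b : IntermediateField.adjoin K {x}) (hb : b ^ 2 = IntermediateField.AdjoinSimple.gen K x) :
    ∃ c : K, c ^ 2 = (-1) ^ (minpoly K x).natDegree * (minpoly K x).coeff 0 := by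
  have hn := Algebra.PowerBasis.norm_gen_eq_coeff_zero_minpoly
    (IntermediateField.adjoin.powerBasis hint)
  rw [IntermediateField.adjoin.powerBasis_gen, IntermediateField.minpoly_gen,
    IntermediateField.adjoin.powerBasis_dim, ← hb, map_pow] at hn
  exact ⟨_, hn⟩

theorem k12_irreducible : Irreducible (kQ.comp (Polynomial.X ^ 2)) := by
  apply Polynomial.irreducible_comp kQ_monic (Polynomial.monic_X_pow 2) kQ_irreducible
  intro E _ _ x hx
  rw [Polynomial.map_pow, Polynomial.map_X]
  apply X_pow_sub_C_irreducible_of_prime Nat.prime_two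
  intro b hb
  have hint : IsIntegral ℚ x := by
    by_contra h
    have := minpoly.eq_zero h
    rw [hx] at this
    exact kQ_monic.ne_zero this
  obtain ⟨c, hc⟩ := norm_aux x hint b hb
  rw [hx, kQ_natDegree] at hc
  have := kQ_coeff
  nlinarith [sq_nonneg c]

/-- apply a functional coefficientwise -/
noncomputable def lamPS (l : ℂ →ₗ[ℚ] ℚ) (f : PowerSeries ℂ) : PowerSeries ℚ :=
  PowerSeries.mk fun n => l (PowerSeries.coeff n f)

theorem lamPS_add (l : ℂ →ₗ[ℚ] ℚ) (f g : PowerSeries ℂ) :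
    lamPS l (f + g) = lamPS l f + lamPS l g := by
  ext n; simp [lamPS]

theorem lamPS_zero (l : ℂ →ₗ[ℚ] ℚ) : lamPS l 0 = 0 := by
  ext n; simp [lamPS]

theorem lamPS_sum (l : ℂ →ₗ[ℚ] ℚ) {ι : Type*} (s : Finset ι) (f : ι → PowerSeries ℂ) :
    lamPS l (∑ i ∈ s, f i) = ∑ i ∈ s, lamPS l (f i) := by
  classical
  induction s using Finset.induction_on with
  | empty => simp [lamPS_zero]
  | insert a s ha ih => rw [Finset.sum_insert ha, Finset.sum_insert ha, lamPS_add, ih]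

theorem lamPS_mul (l : ℂ →ₗ[ℚ] ℚ) (f : PowerSeries ℂ) (g : PowerSeries ℚ) :
    lamPS l (f * PowerSeries.map (algebraMap ℚ ℂ) g) = lamPS l f * g := by
  ext n
  simp only [lamPS, PowerSeries.coeff_mk, PowerSeries.coeff_mul, map_sum, PowerSeries.coeff_map]
  refine Finset.sum_congr rfl fun p _ => ?_
  rw [mul_comm, ← Algebra.smul_def, map_smul, smul_eq_mul, mul_comm]

theorem lamPS_coe (l : ℂ →ₗ[ℚ] ℚ) (p : Polynomial ℂ) :
    lamPS l (p : PowerSeries ℂ)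
      = ((PowerSeries.trunc (p.natDegree + 1) (lamPS l (p : PowerSeries ℂ)) : Polynomial ℚ) :
        PowerSeries ℚ) := by
  ext n
  rw [Polynomial.coeff_coe, PowerSeries.coeff_trunc]
  split_ifs with h
  · rfl
  · simp only [lamPS, PowerSeries.coeff_mk, Polynomial.coeff_coe]
    rw [Polynomial.coeff_eq_zero_of_natDegree_lt (by omega), map_zero]

theorem descent (F : Polynomial (Polynomial ℚ)) (hm : F.Monic) (hirr : Irreducible F)
    (y : PowerSeries ℚ) (hy : Polynomial.aeval y F = 0) (A : Polynomial (Polynomial ℂ))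
    (hA : A ≠ 0)
    (hAy : A.eval₂ Polynomial.coeToPowerSeries.ringHom
      (PowerSeries.map (algebraMap ℚ ℂ) y) = 0) :
    F.natDegree ≤ A.natDegree := by
  obtain ⟨n, hn⟩ : ∃ n, A.coeff n ≠ 0 := ⟨A.natDegree, by simpa using hA⟩
  obtain ⟨m, hm'⟩ : ∃ m, (A.coeff n).coeff m ≠ 0 := ⟨(A.coeff n).natDegree, by simpa using hn⟩
  obtain ⟨l, hl⟩ : ∃ l : ℂ →ₗ[ℚ] ℚ, l ((A.coeff n).coeff m) ≠ 0 := by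
    by_contra! h
    exact hm' ((Module.forall_dual_apply_eq_zero_iff ℚ _).1 h)
  have hnd : n ≤ A.natDegree := Polynomial.le_natDegree_of_ne_zero hn
  let b : ℕ → Polynomial ℚ := fun i =>
    PowerSeries.trunc ((A.coeff i).natDegree + 1) (lamPS l (A.coeff i : PowerSeries ℂ))
  have hb : ∀ i, ((b i : Polynomial ℚ) : PowerSeries ℚ) = lamPS l (A.coeff i : PowerSeries ℂ) :=
    fun i => (lamPS_coe l _).symm
  let B : Polynomial (Polynomial ℚ) :=
    ∑ i ∈ Finset.range (A.natDegree + 1), Polynomial.C (b i) * Polynomial.X ^ i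
  have hBn : B.coeff n = b n := by
    simp only [B, Polynomial.finsetSum_coeff, Polynomial.coeff_C_mul_X_pow]
    rw [Finset.sum_eq_single n]
    · simp
    · intro i _ hi; rw [if_neg (Ne.symm hi)]
    · intro h; simp at h; omega
  have hbn : b n ≠ 0 := by
    intro h
    have h2 := hb n
    rw [h] at h2
    have h3 := congrArg (PowerSeries.coeff m) h2
    simp [lamPS] at h3
    exact hl h3.symm
  have hB0 : B ≠ 0 := by
    intro h; rw [h] at hBn; simp at hBn; exact hbn hBn.symm
  have hBd : B.natDegree ≤ A.natDegree := by
    apply Polynomial.natDegree_sum_le_of_forall_le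
    intro i hi
    refine (Polynomial.natDegree_C_mul_X_pow_le _ _).trans ?_
    simp at hi; omega
  have hBy : Polynomial.aeval y B = 0 := by
    have h0 := congrArg (lamPS l) hAy
    rw [lamPS_zero, Polynomial.eval₂_eq_sum_range, lamPS_sum] at h0
    rw [← h0]
    simp only [B, map_sum, map_mul, map_pow, Polynomial.aeval_C, Polynomial.aeval_X]
    refine Finset.sum_congr rfl fun i _ => ?_
    rw [← map_pow, lamPS_mul, Polynomial.coeToPowerSeries.ringHom_apply, ← hb]
    congr 1
  have hint : IsIntegral (Polynomial ℚ) y := ⟨F, hm, hy⟩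
  have hinj : Function.Injective (algebraMap (Polynomial ℚ) (PowerSeries ℚ)) := by
    intro p q h
    exact Polynomial.coe_injective ℚ h
  have : Module.IsTorsionFree (Polynomial ℚ) (PowerSeries ℚ) :=
    Module.isTorsionFree_iff_algebraMap_injective.2 hinj
  have h1 := minpoly.isIntegrallyClosed_dvd hint hBy
  have h2 := minpoly.isIntegrallyClosed_dvd hint hy
  have h3 : F ∣ minpoly (Polynomial ℚ) y := by
    obtain ⟨r, hr⟩ := h2
    rcases hirr.isUnit_or_isUnit hr with h | h
    · exact absurd h (minpoly.not_isUnit _ _)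
    · obtain ⟨u, rfl⟩ := h
      exact ⟨(↑u⁻¹ : Polynomial (Polynomial ℚ)), by rw [hr, mul_assoc]; simp⟩
  exact (Polynomial.natDegree_le_of_dvd (h3.trans h1) hB0).trans hBd

/-- `c(s) = 1 - 3 s²` -/
noncomputable def cP : Polynomial ℚ := 1 - 3 * Polynomial.X ^ 2

/-- `g(s)` -/
noncomputable def gP : Polynomial ℚ :=
  -297 * Polynomial.X ^ 6 + 135 * Polynomial.X ^ 4 - 135 * Polynomial.X ^ 2 + 9

/-- the family -/
noncomputable def FP : Polynomial (Polynomial ℚ) :=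
  Polynomial.X ^ 12 + Polynomial.C (-41655129 * cP) * Polynomial.X ^ 10
    + Polynomial.C (492741625208256 * cP ^ 2) * Polynomial.X ^ 8
    + Polynomial.C (-3076252392541316657976 * cP ^ 3 + 101196656640784087128 * gP)
      * Polynomial.X ^ 6
    + Polynomial.C (4140769528036890760139930016 * cP ^ 4
        - 89101563751943955818944992 * cP * gP) * Polynomial.X ^ 4
    + Polynomial.C (5170268563875270554876590505052672 * cP ^ 5
        - 651889121899826570379467578891776 * cP ^ 2 * gP) * Polynomial.X ^ 2
    + Polynomial.C (-37637011794778313840666400791469507747840 * cP ^ 6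
        + 6788453098122990377168049757192586084352 * cP ^ 3 * gP
        - 303340463102569219400665610851349864448 * gP ^ 2)

theorem FP_natDegree : FP.natDegree = 12 := by
  unfold FP; compute_degree!

theorem FP_monic : FP.Monic := by
  unfold FP; monicity!

theorem FP_map : FP.map (Polynomial.evalRingHom 1) = kQ.comp (Polynomial.X ^ 2) := by
  have e1 : cP.eval 1 = -2 := by unfold cP; norm_num
  have e2 : gP.eval 1 = -288 := by unfold gP; norm_num
  unfold FP kQ kInt
  simp only [Polynomial.map_add, Polynomial.map_mul, Polynomial.map_pow, Polynomial.map_X,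
    Polynomial.map_C, Polynomial.coe_evalRingHom, Polynomial.eval_add, Polynomial.eval_sub,
    Polynomial.eval_mul, Polynomial.eval_pow, Polynomial.eval_neg, Polynomial.eval_ofNat, e1, e2,
    Polynomial.add_comp, Polynomial.mul_comp, Polynomial.pow_comp, Polynomial.X_comp,
    Polynomial.C_comp]
  norm_num
  ring

theorem FP_irreducible : Irreducible FP :=
  FP_monic.irreducible_of_irreducible_map (Polynomial.evalRingHom 1) FP
    (FP_map ▸ k12_irreducible)

theorem cc_eval (G : Polynomial (Polynomial ℚ)) :
    PowerSeries.constantCoeff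
      ((G.map (algebraMap (Polynomial ℚ) (PowerSeries ℚ))).eval 1077)
      = (G.map (Polynomial.evalRingHom 0)).eval 1077 := by
  have e : (PowerSeries.constantCoeff (R := ℚ)).comp
      (algebraMap (Polynomial ℚ) (PowerSeries ℚ)) = Polynomial.evalRingHom 0 := by
    refine RingHom.ext fun p => ?_
    show PowerSeries.constantCoeff ((p : Polynomial ℚ) : PowerSeries ℚ) = p.eval 0
    rw [← Polynomial.coeff_zero_eq_eval_zero]
    simp
  rw [Polynomial.eval_map, Polynomial.hom_eval₂, e, map_ofNat, Polynomial.eval_map]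

theorem FP_map0 : FP.map (Polynomial.evalRingHom 0) =
    Polynomial.X ^ 12 + Polynomial.C (-41655129) * Polynomial.X ^ 10
    + Polynomial.C (492741625208256) * Polynomial.X ^ 8
    + Polynomial.C (-3076252392541316657976 + 101196656640784087128 * 9)
      * Polynomial.X ^ 6
    + Polynomial.C (4140769528036890760139930016
        - 89101563751943955818944992 * 9) * Polynomial.X ^ 4
    + Polynomial.C (5170268563875270554876590505052672
        - 651889121899826570379467578891776 * 9) * Polynomial.X ^ 2
    + Polynomial.C (-37637011794778313840666400791469507747840
        + 6788453098122990377168049757192586084352 * 9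
        - 303340463102569219400665610851349864448 * 9 ^ 2) := by
  have e1 : cP.eval 0 = 1 := by unfold cP; norm_num
  have e2 : gP.eval 0 = 9 := by unfold gP; norm_num
  unfold FP
  simp only [Polynomial.map_add, Polynomial.map_mul, Polynomial.map_pow, Polynomial.map_X,
    Polynomial.map_C, Polynomial.coe_evalRingHom, Polynomial.eval_add, Polynomial.eval_sub,
    Polynomial.eval_mul, Polynomial.eval_pow, Polynomial.eval_neg, Polynomial.eval_ofNat, e1, e2,
    one_pow, mul_one]

theorem exists_root : ∃ y : PowerSeries ℚ, Polynomial.aeval y FP = 0 := by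
  have key := HenselianRing.is_henselian (I := Ideal.span {(PowerSeries.X : PowerSeries ℚ)})
    (FP.map (algebraMap (Polynomial ℚ) (PowerSeries ℚ))) (FP_monic.map _) 1077 ?_ ?_
  · obtain ⟨y, hy, -⟩ := key
    refine ⟨y, ?_⟩
    rw [Polynomial.IsRoot, Polynomial.eval_map_algebraMap] at hy
    exact hy
  · rw [Ideal.mem_span_singleton, PowerSeries.X_dvd_iff, cc_eval, FP_map0]
    simp only [Polynomial.eval_add, Polynomial.eval_mul, Polynomial.eval_pow, Polynomial.eval_X,
      Polynomial.eval_C]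
    norm_num
  · apply IsUnit.map
    rw [PowerSeries.isUnit_iff_constantCoeff, Polynomial.derivative_map, cc_eval,
      ← Polynomial.derivative_map, FP_map0, isUnit_iff_ne_zero]
    simp only [Polynomial.derivative_add, Polynomial.derivative_C_mul, Polynomial.derivative_X_pow,
      Polynomial.derivative_C, Polynomial.eval_add, Polynomial.eval_mul, Polynomial.eval_pow,
      Polynomial.eval_X, Polynomial.eval_C, Polynomial.eval_zero]
    norm_num

/-- the substitution -/
noncomputable def sub (w : ℂ) : Fin 3 → Polynomial (Polynomial ℂ) :=
  ![Polynomial.C (Polynomial.C w * Polynomial.X), 1,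
    Polynomial.C (Polynomial.C (1 / 4308)) * Polynomial.X]

theorem sub_natDegree (w : ℂ) (i : Fin 3) : (sub w i).natDegree ≤ 1 := by
  fin_cases i
  · show (Polynomial.C _).natDegree ≤ 1
    rw [Polynomial.natDegree_C]; exact zero_le_one
  · simp [sub]
  · show (Polynomial.C _ * Polynomial.X).natDegree ≤ 1
    exact (Polynomial.natDegree_C_mul_le _ _).trans Polynomial.natDegree_X_le

/-- the substitution hom -/
noncomputable def phi (w : ℂ) : PolyC →+* Polynomial (Polynomial ℂ) :=
  MvPolynomial.eval₂Hom (Polynomial.C.comp Polynomial.C) (sub w)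

theorem phi_natDegree (w : ℂ) (P : PolyC) : (phi w P).natDegree ≤ P.totalDegree := by
  have h : phi w P = MvPolynomial.aeval (sub w) (MvPolynomial.map Polynomial.C P) := by
    rw [MvPolynomial.aeval_def, MvPolynomial.eval₂_map]; rfl
  rw [h]
  have := MvPolynomial.aeval_natDegree_le (MvPolynomial.map Polynomial.C P)
    (m := P.totalDegree) (n := 1) (Finset.sup_mono (MvPolynomial.support_map_subset _ _)) (sub w) (sub_natDegree w)
  simpa using this

/-- base change -/
noncomputable def FC : Polynomial (Polynomial ℂ) :=
  FP.map (Polynomial.mapRingHom (algebraMap ℚ ℂ))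

theorem phi_f1 (w : ℂ) : phi w f1 = Polynomial.C (Polynomial.C (1 / 4308)) * Polynomial.X := by
  simp [phi, f1, sub]

theorem phi_f2 (w : ℂ) (hw : w ^ 2 = -3) :
    phi w f2 = Polynomial.C (cP.map (algebraMap ℚ ℂ)) := by
  have hW : (Polynomial.C (Polynomial.C w)) ^ 2 = -3 := by
    rw [← map_pow, ← map_pow, hw]; simp only [map_neg, map_ofNat]
  have h : phi w f2 = (Polynomial.C (Polynomial.C w) * Polynomial.C Polynomial.X) ^ 2 + 1 ^ 2 := by
    simp [phi, f2, sub]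
  rw [h]
  unfold cP
  simp only [Polynomial.map_sub, Polynomial.map_one, Polynomial.map_mul, Polynomial.map_pow,
    Polynomial.map_X, Polynomial.map_ofNat, map_sub, map_one, map_mul, map_pow, map_ofNat]
  linear_combination (Polynomial.C Polynomial.X) ^ 2 * hW

theorem phi_f3 (w : ℂ) (hw : w ^ 2 = -3) :
    phi w f3 = Polynomial.C (gP.map (algebraMap ℚ ℂ)) := by
  have hW : (Polynomial.C (Polynomial.C w)) ^ 2 = -3 := by
    rw [← map_pow, ← map_pow, hw]; simp only [map_neg, map_ofNat]
  have hC : ∀ a : ℂ, phi w (C a) = Polynomial.C (Polynomial.C a) := fun a => by simp [phi]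
  have h0 : phi w (X 0) = Polynomial.C (Polynomial.C w) * Polynomial.C Polynomial.X := by
    simp [phi, sub]
  have h1 : phi w (X 1) = 1 := by simp [phi, sub]
  unfold f3 gP
  simp only [Polynomial.map_sub, Polynomial.map_add, Polynomial.map_neg, Polynomial.map_mul,
    Polynomial.map_pow, Polynomial.map_X, Polynomial.map_ofNat, map_sub, map_add, map_neg,
    map_mul, map_pow, map_ofNat, hC, h0, h1]
  generalize Polynomial.C (Polynomial.C w) = W at *
  generalize (Polynomial.C Polynomial.X : Polynomial (Polynomial ℂ)) = S at *
  linear_combination (11 * S ^ 6 * (W ^ 4 - 3 * W ^ 2 + 9) + 15 * S ^ 4 * (W ^ 2 - 3)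
    + 45 * S ^ 2) * hW

theorem phi_Γ (w : ℂ) (hw : w ^ 2 = -3) :
    phi w Γpoly = Polynomial.C (Polynomial.C (2093688 / 17 / 4308 ^ 12)) * FC := by
  obtain ⟨D, hD⟩ : ∃ D : ℂ →+* Polynomial (Polynomial ℂ),
      ∀ a, Polynomial.C (Polynomial.C a) = D a := ⟨Polynomial.C.comp Polynomial.C, fun _ => rfl⟩
  have hC : ∀ a : ℂ, phi w (C a) = D a := fun a => by rw [← hD]; simp [phi]
  unfold Γpoly
  simp only [map_add, map_sub, map_mul, map_pow, hC, phi_f1, phi_f2 w hw, phi_f3 w hw]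
  unfold FC FP
  simp only [Polynomial.map_add, Polynomial.map_sub, Polynomial.map_mul, Polynomial.map_pow,
    Polynomial.map_X, Polynomial.map_C, Polynomial.coe_mapRingHom, Polynomial.map_ofNat,
    Polynomial.map_neg, map_add, map_sub, map_mul, map_pow, map_neg, map_ofNat, hD]
  generalize Polynomial.C (Polynomial.map (algebraMap ℚ ℂ) cP) = c
  generalize Polynomial.C (Polynomial.map (algebraMap ℚ ℂ) gP) = g
  have key : ∀ (a : ℂ) (i n : ℕ), a * (1 / 4308) ^ i = 2093688 / 17 / 4308 ^ 12 * (n : ℂ) →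
      D a * D (1 / 4308) ^ i = D (2093688 / 17 / 4308 ^ 12) * (n : Polynomial (Polynomial ℂ)) := by
    intro a i n h
    rw [← map_pow, ← map_mul, h, map_mul, map_natCast]
  have h0 := key (2093688/17) 12 1 (by norm_num)
  have h1 := key (9398511/34) 10 41655129 (by norm_num)
  have h2 := key (2995218/17) 8 492741625208256 (by norm_num)
  have h3 := key (64485153/1088) 6 3076252392541316657976 (by norm_num)
  have h4 := key (18708003/4352) 4 4140769528036890760139930016 (by norm_num)
  have h5 := key (1258659/4352) 2 5170268563875270554876590505052672 (by norm_num)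
  have h6 := key (493695/4352) 0 37637011794778313840666400791469507747840 (by norm_num)
  have h7 := key (2121309/1088) 6 101196656640784087128 (by norm_num)
  have h8 := key (402561/4352) 4 89101563751943955818944992 (by norm_num)
  have h9 := key (158697/4352) 2 651889121899826570379467578891776 (by norm_num)
  have h10 := key (2619/128) 0 6788453098122990377168049757192586084352 (by norm_num)
  have h11 := key (3979/4352) 0 303340463102569219400665610851349864448 (by norm_num)
  push_cast at h0 h1 h2 h3 h4 h5 h6 h7 h8 h9 h10 h11
  linear_combination h0 * (Polynomial.X ^ 12 * c ^ 0 * g ^ 0)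
    - h1 * (Polynomial.X ^ 10 * c ^ 1 * g ^ 0)
    + h2 * (Polynomial.X ^ 8 * c ^ 2 * g ^ 0)
    - h3 * (Polynomial.X ^ 6 * c ^ 3 * g ^ 0)
    + h4 * (Polynomial.X ^ 4 * c ^ 4 * g ^ 0)
    + h5 * (Polynomial.X ^ 2 * c ^ 5 * g ^ 0)
    - h6 * (Polynomial.X ^ 0 * c ^ 6 * g ^ 0)
    + h7 * (Polynomial.X ^ 6 * c ^ 0 * g ^ 1)
    - h8 * (Polynomial.X ^ 4 * c ^ 1 * g ^ 1)
    - h9 * (Polynomial.X ^ 2 * c ^ 2 * g ^ 1)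
    + h10 * (Polynomial.X ^ 0 * c ^ 3 * g ^ 1)
    - h11 * (Polynomial.X ^ 0 * c ^ 0 * g ^ 2)

theorem Γ_totalDegree : Γpoly.totalDegree ≤ 12 := by
  have x : ∀ (i : Fin 3), (X i : PolyC).IsHomogeneous 1 := fun i => MvPolynomial.isHomogeneous_X _ _
  have hf1 : f1.IsHomogeneous 1 := x 2
  have hf2 : f2.IsHomogeneous 2 := ((x 0).pow 2).add ((x 1).pow 2)
  have cm : ∀ (a : ℂ) {p : PolyC} {n : ℕ}, p.IsHomogeneous n → (C a * p).IsHomogeneous n :=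
    fun a p n h => by simpa using (MvPolynomial.isHomogeneous_C (Fin 3) a).mul h
  have hf3 : f3.IsHomogeneous 6 := by
    unfold f3
    simp only [mul_assoc]
    exact (((cm _ ((x 0).pow 6)).add (cm _ (((x 0).pow 4).mul ((x 1).pow 2)))).add
      (cm _ (((x 0).pow 2).mul ((x 1).pow 4)))).add (cm _ ((x 1).pow 6))
  have h : Γpoly.IsHomogeneous 12 := by
    unfold Γpoly
    simp only [mul_assoc]
    refine (((((((((((cm _ (hf1.pow 12)).sub (cm _ ((hf1.pow 10).mul hf2))).add
      (cm _ ((hf1.pow 8).mul (hf2.pow 2)))).sub (cm _ ((hf1.pow 6).mul (hf2.pow 3)))).add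
      (cm _ ((hf1.pow 4).mul (hf2.pow 4)))).add (cm _ ((hf1.pow 2).mul (hf2.pow 5)))).sub
      (cm _ (hf2.pow 6))).add (cm _ ((hf1.pow 6).mul hf3))).sub
      (cm _ ((hf1.pow 4).mul (hf2.mul hf3)))).sub
      (cm _ ((hf1.pow 2).mul ((hf2.pow 2).mul hf3)))).add
      (cm _ ((hf2.pow 3).mul hf3))).sub (cm _ (hf3.pow 2))
  exact h.totalDegree_le

theorem FC_monic : FC.Monic := FP_monic.map _

theorem FC_natDegree : FC.natDegree = 12 := by
  rw [FC, FP_monic.natDegree_map, FP_natDegree]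

theorem unit_aux (w : ℂ) (P Q : PolyC) (hP : P ≠ 0) (hQ : Q ≠ 0)
    (hdeg : (P * Q).totalDegree ≤ 12) (h12 : 12 ≤ (phi w P).natDegree) : IsUnit Q := by
  rw [MvPolynomial.totalDegree_mul_of_isDomain hP hQ] at hdeg
  have h1 := phi_natDegree w P
  have h2 : Q.totalDegree = 0 := by omega
  rw [MvPolynomial.totalDegree_eq_zero_iff_eq_C] at h2
  rw [h2]
  apply IsUnit.map
  rw [isUnit_iff_ne_zero]
  intro h
  rw [h] at h2
  exact hQ (by simpa using h2)

/-- The degree-12 form `Γ` is irreducible in `ℂ[x,y,z]`; in particular the plane curve of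
degree 12 it defines is irreducible. -/
theorem stmt14 : Irreducible Γpoly := by
  obtain ⟨w, hw⟩ : ∃ w : ℂ, w ^ 2 = -3 := IsAlgClosed.exists_pow_nat_eq (-3) (by norm_num)
  obtain ⟨y, hy⟩ := exists_root
  have hΓ := phi_Γ w hw
  have hk : (Polynomial.C (Polynomial.C (2093688 / 17 / 4308 ^ 12 : ℂ))) ≠ 0 := by
    rw [Ne, Polynomial.C_eq_zero, Polynomial.C_eq_zero]; norm_num
  have hΓ0 : phi w Γpoly ≠ 0 := by
    rw [hΓ]; exact mul_ne_zero hk FC_monic.ne_zero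
  have hdegΓ : (phi w Γpoly).natDegree = 12 := by
    rw [hΓ, Polynomial.natDegree_C_mul (by simpa using hk), FC_natDegree]
  have hroot : FC.eval₂ Polynomial.coeToPowerSeries.ringHom
      (PowerSeries.map (algebraMap ℚ ℂ) y) = 0 := by
    have h := congrArg (PowerSeries.map (algebraMap ℚ ℂ)) hy
    rw [map_zero, Polynomial.aeval_def, Polynomial.hom_eval₂] at h
    rw [FC, Polynomial.eval₂_map, ← h]
    congr 1
    refine RingHom.ext fun p => ?_
    show ((p.map (algebraMap ℚ ℂ) : Polynomial ℂ) : PowerSeries ℂ)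
      = PowerSeries.map (algebraMap ℚ ℂ) (p : PowerSeries ℚ)
    ext n; simp
  refine ⟨?_, ?_⟩
  · intro hu
    have := (hu.map (phi w))
    have h0 := Polynomial.natDegree_eq_zero_of_isUnit this
    omega
  · intro P Q hPQ
    have hP : P ≠ 0 := by rintro rfl; rw [zero_mul] at hPQ; exact hΓ0 (by rw [hPQ, map_zero])
    have hQ : Q ≠ 0 := by rintro rfl; rw [mul_zero] at hPQ; exact hΓ0 (by rw [hPQ, map_zero])
    have hprod : phi w P * phi w Q ≠ 0 := by rw [← map_mul, ← hPQ]; exact hΓ0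
    have hev : (phi w P * phi w Q).eval₂ Polynomial.coeToPowerSeries.ringHom
        (PowerSeries.map (algebraMap ℚ ℂ) y) = 0 := by
      rw [← map_mul, ← hPQ, hΓ, Polynomial.eval₂_mul, hroot, mul_zero]
    have htd := Γ_totalDegree
    rw [Polynomial.eval₂_mul] at hev
    rcases mul_eq_zero.1 hev with h | h
    · right
      have := descent FP FP_monic FP_irreducible y hy _ (left_ne_zero_of_mul hprod) h
      rw [FP_natDegree] at this
      exact unit_aux w P Q hP hQ (hPQ ▸ htd) this
    · left
      have := descent FP FP_monic FP_irreducible y hy _ (right_ne_zero_of_mul hprod) h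
      rw [FP_natDegree] at this
      exact unit_aux w Q P hQ hP (by rw [mul_comm, ← hPQ]; exact htd) this
end

section
/- Let f₁ = z, f₂ = x²+y², f₃ = 11x⁶+15x⁴y²+45x²y⁴+9y⁶ and let Δ = −(38320128/107)f₁¹⁰ + (80453952/107)f₁⁸f₂ − (42393996/4107)f₁⁶f₂² + (50759217/214)f₁⁴f₂³ − (20519091/856)f₁²f₂⁴ + (67086/107)f₂⁵ − (3811059/214)f₁⁴f₃ + (1778227/856)f₁²f₂f₃ − (6089/107)f₂²f₃, regarded as a homogeneous polynomial of degree 10 in ℂ[x,y,z]. Then Δ is irreducible in ℂ[x,y,z]; in particular the plane curve of degree 10 it defines is irreducible. -/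
open MvPolynomial

noncomputable section

/-- The degree-10 form `Δ`, expressed in terms of the invariants `f₁`, `f₂`, `f₃`,
regarded as an element of `ℂ[x,y,z]`. -/
def Δpoly : PolyC :=
  - C (38320128/107) * f1 ^ 10 + C (80453952/107) * f1 ^ 8 * f2
    - C (42393996/4107) * f1 ^ 6 * f2 ^ 2 + C (50759217/214) * f1 ^ 4 * f2 ^ 3
    - C (20519091/856) * f1 ^ 2 * f2 ^ 4 + C (67086/107) * f2 ^ 5
    - C (3811059/214) * f1 ^ 4 * f3 + C (1778227/856) * f1 ^ 2 * f2 * f3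
    - C (6089/107) * f2 ^ 2 * f3

end

open scoped Polynomial
namespace Polynomial

/-- The auxiliary polynomial. -/
noncomputable def Phi (P Q : ℂ[X]) : ℂ[X][X] :=
  C (Q * X ^ 6) * X ^ 12 - C (2 * P) * X ^ 6 + C Q

lemma Phi_coeff0 (P Q : ℂ[X]) : (Phi P Q).coeff 0 = Q := by
  simp [Phi, coeff_X_pow]
lemma Phi_coeff6 (P Q : ℂ[X]) : (Phi P Q).coeff 6 = - (2 * P) := by
  simp only [Phi, coeff_add, coeff_sub, coeff_C_mul, coeff_X_pow, coeff_C]; norm_num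
lemma Phi_coeff12 (P Q : ℂ[X]) : (Phi P Q).coeff 12 = Q * X ^ 6 := by
  simp only [Phi, coeff_add, coeff_sub, coeff_C_mul, coeff_X_pow, coeff_C]; norm_num

lemma Phi_natDegree (P Q : ℂ[X]) (hQ : Q ≠ 0) : (Phi P Q).natDegree = 12 := by
  unfold Phi
  have : Q * X ^ 6 ≠ 0 := mul_ne_zero hQ (pow_ne_zero _ X_ne_zero)
  compute_degree!

lemma Phi_const (P Q : ℂ[X]) (h : IsCoprime P Q) (e : ℂ[X]) (he : C e ∣ Phi P Q) : IsUnit e := by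
  rw [C_dvd_iff_dvd_coeff] at he
  have h0 := he 0
  have h6 := he 6
  rw [Phi_coeff0] at h0
  rw [Phi_coeff6, dvd_neg] at h6
  have h2 : IsUnit (2 : ℂ[X]) := by
    have : (2 : ℂ[X]) = C 2 := (map_ofNat C 2).symm
    rw [this]; exact (isUnit_iff_ne_zero.2 two_ne_zero).map C
  exact h.isUnit_of_dvd' ((IsUnit.dvd_mul_left h2).1 h6) h0

lemma aux_deg6 (P Q : ℂ[X]) (r0 : ℂ) (Q1 : ℂ[X]) (hQ : Q = (X - C r0) * Q1)
    (hQ1 : Q1.eval r0 ≠ 0) (hP : P.eval r0 ≠ 0) (hPQ : IsCoprime P Q)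
    (hP0 : P.eval 0 ≠ 0) (h5 : (P - X ^ 3 * Q).natDegree = 5)
    (F G : ℂ[X][X]) (h : Phi P Q = F * G) (hF : F.leadingCoeff.eval r0 ≠ 0) : IsUnit F := by
  have hQ0 : Q ≠ 0 := by
    rw [hQ]; exact mul_ne_zero (X_sub_C_ne_zero _) (by rintro rfl; simp at hQ1)
  have hQr : Q.eval r0 = 0 := by rw [hQ]; simp
  have hΦ0 : Phi P Q ≠ 0 := by
    intro h0; have := Phi_natDegree P Q hQ0; rw [h0] at this; simp at this
  have hF0 : F ≠ 0 := by rintro rfl; simp at h; exact hΦ0 h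
  have hG0 : G ≠ 0 := by rintro rfl; simp at h; exact hΦ0 h
  have hdeg : F.natDegree + G.natDegree = 12 := by
    rw [← natDegree_mul hF0 hG0, ← h, Phi_natDegree P Q hQ0]
  set φ := evalRingHom r0 with hφ
  have hmap : F.map φ * G.map φ = C (-(2 * P.eval r0)) * X ^ 6 := by
    rw [← Polynomial.map_mul, ← h]
    simp [Phi, hφ, hQr]
  have hFn : (F.map φ).natDegree = F.natDegree := natDegree_map_of_leadingCoeff_ne_zero _ hF
  have hc : (-(2 * P.eval r0)) ≠ 0 := by simpa using hP
  have hne : F.map φ * G.map φ ≠ 0 := by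
    rw [hmap]; exact mul_ne_zero (by simpa using hP) (pow_ne_zero _ X_ne_zero)
  have hFm0 : F.map φ ≠ 0 := left_ne_zero_of_mul hne
  have hGm0 : G.map φ ≠ 0 := right_ne_zero_of_mul hne
  have hdegm : (F.map φ).natDegree + (G.map φ).natDegree = 6 := by
    rw [← natDegree_mul hFm0 hGm0, hmap, natDegree_C_mul_X_pow _ _ hc]
  by_cases ha : F.natDegree = 0
  · obtain ⟨f, rfl⟩ := natDegree_eq_zero.1 ha
    exact (Phi_const P Q hPQ f ⟨G, h⟩).map C
  exfalso
  have hassoc : ∃ i ≤ 6, Associated (F.map φ) (X ^ i) := by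
    apply (dvd_prime_pow prime_X 6).1
    have : F.map φ ∣ C (-(2 * P.eval r0)) * X ^ 6 := ⟨_, hmap.symm⟩
    rwa [IsUnit.dvd_mul_left ((isUnit_iff_ne_zero.2 hc).map C)] at this
  obtain ⟨i, -, hi⟩ := hassoc
  have hideg : i = F.natDegree := by
    rw [← hFn, natDegree_eq_of_degree_eq (degree_eq_degree_of_associated hi), natDegree_X_pow]
  have hFc0 : (F.coeff 0).eval r0 = 0 := by
    have h1 : (X : ℂ[X]) ∣ F.map φ := (dvd_pow_self X (by omega : i ≠ 0)).trans hi.symm.dvd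
    rw [X_dvd_iff, coeff_map] at h1
    exact h1
  have hprod0 : F.coeff 0 * G.coeff 0 = Q := by
    rw [← mul_coeff_zero, ← h, Phi_coeff0]
  have hGc0 : (G.coeff 0).eval r0 ≠ 0 := by
    intro hg
    obtain ⟨a, ha⟩ := dvd_iff_isRoot.2 hFc0
    obtain ⟨b, hb⟩ := dvd_iff_isRoot.2 hg
    rw [ha, hb, hQ, mul_assoc] at hprod0
    have := mul_left_cancel₀ (X_sub_C_ne_zero r0) hprod0
    rw [← this] at hQ1
    simp at hQ1
  have hGm : (G.map φ).natDegree = 0 := by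
    have : ∃ i ≤ 6, Associated (G.map φ) (X ^ i) := by
      apply (dvd_prime_pow prime_X 6).1
      have : G.map φ ∣ C (-(2 * P.eval r0)) * X ^ 6 := ⟨F.map φ, by rw [← hmap, mul_comm]⟩
      rwa [IsUnit.dvd_mul_left ((isUnit_iff_ne_zero.2 hc).map C)] at this
    obtain ⟨j, -, hj⟩ := this
    have hjd : j = (G.map φ).natDegree := by
      rw [natDegree_eq_of_degree_eq (degree_eq_degree_of_associated hj), natDegree_X_pow]
    by_contra hne0
    have h1 : (X : ℂ[X]) ∣ G.map φ := (dvd_pow_self X (by omega : j ≠ 0)).trans hj.symm.dvd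
    rw [X_dvd_iff, coeff_map] at h1
    exact hGc0 h1
  have hF6 : F.natDegree = 6 := by omega
  have hG6 : G.natDegree = 6 := by omega
  -- symmetry
  obtain ⟨ζ, hζ⟩ : ∃ ζ : ℂ, IsPrimitiveRoot ζ 6 := ⟨_, Complex.isPrimitiveRoot_exp 6 (by norm_num)⟩
  have hζ6 : ζ ^ 6 = 1 := hζ.pow_eq_one
  have hζ0 : ζ ≠ 0 := hζ.ne_zero (by norm_num)
  set s : ℂ[X][X] := C (C ζ) * X with hs
  have hs6 : s ^ 6 = X ^ 6 := by rw [hs, mul_pow, ← C_pow, ← C_pow, hζ6]; simp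
  have hΦs : (Phi P Q).comp s = Phi P Q := by
    have hs12 : s ^ 12 = X ^ 12 := by
      rw [show (12:ℕ) = 6 * 2 by norm_num, pow_mul, hs6, pow_mul]
    simp only [Phi, add_comp, sub_comp, mul_comp, C_comp, pow_comp, X_comp, hs6, hs12]
  have hsc : ∀ (K : ℂ[X][X]) n, (K.comp s).coeff n = K.coeff n * C ζ ^ n := by
    intro K n; rw [hs, comp_C_mul_X_coeff]
  have hFs_dvd : F.comp s ∣ F * G := by
    rw [← h, ← hΦs, h, mul_comp]; exact dvd_mul_right _ _
  have hsdeg : (F.comp s).natDegree = 6 := by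
    rw [natDegree_comp, hF6, hs, natDegree_C_mul_X _ (by simpa using hζ0)]
  have hFs0 : F.comp s ≠ 0 := by intro h0; rw [h0] at hsdeg; simp at hsdeg
  have hrel : IsRelPrime (F.comp s) G := by
    rintro d ⟨k, hk⟩ hdG
    have hd0 : d ≠ 0 := by rintro rfl; simp at hk; exact hFs0 hk
    have hlc : d.leadingCoeff.eval r0 ≠ 0 := by
      intro h0
      have : (F.comp s).leadingCoeff.eval r0 = 0 := by rw [hk, leadingCoeff_mul]; simp [h0]
      rw [leadingCoeff, hsdeg, hsc, ← hF6] at this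
      simp only [eval_mul, eval_pow, eval_C] at this
      exact mul_ne_zero hF (pow_ne_zero _ hζ0) this
    have hdn : (d.map φ).natDegree = d.natDegree := natDegree_map_of_leadingCoeff_ne_zero _ hlc
    have hle : (d.map φ).natDegree ≤ (G.map φ).natDegree :=
      natDegree_le_of_dvd (Polynomial.map_dvd φ hdG) hGm0
    obtain ⟨e, rfl⟩ := natDegree_eq_zero.1 (by omega : d.natDegree = 0)
    exact (Phi_const P Q hPQ e (hdG.trans ⟨F, by rw [h, mul_comm]⟩)).map C
  obtain ⟨k, hk⟩ := hrel.dvd_of_dvd_mul_right hFs_dvd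
  have hk0 : k ≠ 0 := by rintro rfl; simp at hk; exact hF0 hk
  have hkd : k.natDegree = 0 := by
    have := natDegree_mul hFs0 hk0
    rw [← hk] at this; omega
  obtain ⟨κ, rfl⟩ := natDegree_eq_zero.1 hkd
  have hco : ∀ n, F.coeff n = F.coeff n * C ζ ^ n * κ := by
    intro n
    conv_lhs => rw [hk]
    rw [coeff_mul_C, hsc]
  have hf6 : F.coeff 6 ≠ 0 := by
    rw [← hF6]; exact leadingCoeff_ne_zero.2 hF0
  have hκ : κ = 1 := by
    have := hco 6
    rw [← C_pow, hζ6, C_1, mul_one] at this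
    exact (mul_left_cancel₀ hf6 (by rw [mul_one]; exact this)).symm
  have hz : ∀ n, 0 < n → n < 6 → F.coeff n = 0 := by
    intro n hn hn6
    have h1 := hco n
    rw [hκ, mul_one] at h1
    by_contra h0
    have h2 : (1 : ℂ[X]) = C ζ ^ n := mul_left_cancel₀ h0 (by rw [mul_one]; exact h1)
    rw [← C_pow, ← C_1, C_inj] at h2
    exact hζ.pow_ne_one_of_pos_of_lt hn.ne' hn6 h2.symm
  have e6 : F.coeff 6 * G.coeff 0 + F.coeff 0 * G.coeff 6 = -(2 * P) := by
    rw [← Phi_coeff6 P Q, h, coeff_mul, Finset.Nat.sum_antidiagonal_eq_sum_range_succ_mk]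
    simp [Finset.sum_range_succ, hz]
    ring
  have e12 : F.coeff 6 * G.coeff 6 = Q * X ^ 6 := by
    rw [← Phi_coeff12 P Q, h]
    have := coeff_mul_degree_add_degree F G
    rw [hF6, hG6] at this
    rw [this, leadingCoeff, leadingCoeff, hF6, hG6]
  have hsq : (P - X ^ 3 * Q) * (P + X ^ 3 * Q) =
      (C (1/2) * (F.coeff 6 * G.coeff 0 - F.coeff 0 * G.coeff 6)) ^ 2 := by
    have hC : (C (1/2) : ℂ[X]) ^ 2 * 4 = 1 := by
      rw [show (4 : ℂ[X]) = C 4 from (map_ofNat C 4).symm, ← C_pow, ← C_mul]; norm_num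
    linear_combination (-C (1/2) ^ 2 * (F.coeff 6 * G.coeff 0 + F.coeff 0 * G.coeff 6 - 2 * P)) * e6
      + (4 * C (1/2) ^ 2 * F.coeff 0 * G.coeff 0) * e12
      + (4 * C (1/2) ^ 2 * (Q * X ^ 6)) * hprod0
      - (P ^ 2 - X ^ 6 * Q ^ 2) * hC
  have hcop : IsCoprime (P - X ^ 3 * Q) (P + X ^ 3 * Q) := by
    have hX : IsCoprime P (X ^ 3) := by
      apply IsCoprime.pow_right
      apply IsCoprime.symm
      rw [show (X : ℂ[X]) = X - C 0 by simp]
      apply (irreducible_X_sub_C 0).coprime_iff_not_dvd.2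
      rw [dvd_iff_isRoot]; exact hP0
    have h1 : IsCoprime P (X ^ 3 * Q) := hX.mul_right hPQ
    obtain ⟨a, b, hab⟩ := h1
    refine ⟨C (1/2) * (a - b), C (1/2) * (a + b), ?_⟩
    have hC : (C (1/2) : ℂ[X]) * 2 = 1 := by
      rw [show (2 : ℂ[X]) = C 2 from (map_ofNat C 2).symm, ← C_mul]; norm_num
    linear_combination hab + (a * P + b * (X ^ 3 * Q)) * hC
  obtain ⟨d, hd⟩ := exists_associated_pow_of_mul_eq_pow' hcop hsq
  have := natDegree_eq_of_degree_eq (degree_eq_degree_of_associated hd)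
  rw [h5, natDegree_pow] at this
  omega

lemma Phi_irreducible (P Q : ℂ[X]) (r0 : ℂ) (Q1 : ℂ[X]) (hQ : Q = (X - C r0) * Q1)
    (hQ1 : Q1.eval r0 ≠ 0) (hr0 : r0 ≠ 0) (hP : P.eval r0 ≠ 0) (hPQ : IsCoprime P Q)
    (hP0 : P.eval 0 ≠ 0) (h5 : (P - X ^ 3 * Q).natDegree = 5) : Irreducible (Phi P Q) := by
  have hQ0 : Q ≠ 0 := by
    rw [hQ]; exact mul_ne_zero (X_sub_C_ne_zero _) (by rintro rfl; simp at hQ1)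
  have hd := Phi_natDegree P Q hQ0
  refine ⟨fun hu => ?_, fun F G h => ?_⟩
  · rw [natDegree_eq_zero_of_isUnit hu] at hd; omega
  · by_cases hF : F.leadingCoeff.eval r0 = 0
    · right
      refine aux_deg6 P Q r0 Q1 hQ hQ1 hP hPQ hP0 h5 G F (by rw [h, mul_comm]) fun hg => ?_
      have hl : F.leadingCoeff * G.leadingCoeff = Q * X ^ 6 := by
        rw [← leadingCoeff_mul, ← h, leadingCoeff, hd, Phi_coeff12]
      obtain ⟨a, ha⟩ := dvd_iff_isRoot.2 hF
      obtain ⟨b, hb⟩ := dvd_iff_isRoot.2 hg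
      rw [ha, hb, hQ, mul_assoc, mul_assoc] at hl
      have := mul_left_cancel₀ (X_sub_C_ne_zero r0) hl
      have h3 := congrArg (eval r0) this
      simp at h3
      tauto
    · exact Or.inl (aux_deg6 P Q r0 Q1 hQ hQ1 hP hPQ hP0 h5 F G h hF)

noncomputable def theta : ℂ[X][X] →+* ℂ[X][X] :=
  eval₂RingHom (eval₂RingHom (C.comp C) (C X * X ^ 2)) X

lemma theta_eval (G : ℂ[X][X]) (s z : ℂ) (hz : z ≠ 0) :
    ((theta G).map (evalRingHom (s / z ^ 2))).eval z = (G.map (evalRingHom s)).eval z := by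
  have : ((evalRingHom z).comp (mapRingHom (evalRingHom (s / z ^ 2)))).comp theta
      = (evalRingHom z).comp (mapRingHom (evalRingHom s)) := by
    apply Polynomial.ringHom_ext'
    · apply Polynomial.ringHom_ext'
      · ext; simp [theta]
      · simp [theta]; field_simp
    · simp [theta]
  simpa using congrArg (fun f => f G) this

lemma aux_unit (H Φ G K : ℂ[X][X]) (k : ℂ) (hk : k ≠ 0) (hΦ : Irreducible Φ)
    (hH : theta H = C (C k) * X ^ 4 * Φ) (s0 : ℂ) (hs : (H.map (evalRingHom s0)).eval 0 ≠ 0)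
    (hG : G.Monic) (hGK : K * G = H) (hd : Φ ∣ theta K) : G.natDegree = 0 := by
  obtain ⟨L, hL⟩ := hd
  have h1 : L * theta G = C (C k) * X ^ 4 := by
    apply mul_left_cancel₀ hΦ.ne_zero
    rw [← mul_assoc, ← hL, ← map_mul, hGK, hH]; ring
  have hkU : IsUnit (C (C k) : ℂ[X][X]) := ((isUnit_iff_ne_zero.2 hk).map C).map C
  have h2 : theta G ∣ X ^ 4 := by
    rw [← IsUnit.dvd_mul_left hkU, ← h1]; exact dvd_mul_left _ _
  obtain ⟨i, -, hi⟩ := (dvd_prime_pow prime_X 4).1 h2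
  obtain ⟨u, hu⟩ := hi.symm
  obtain ⟨a, ha, hau⟩ := Polynomial.isUnit_iff.1 u.isUnit
  obtain ⟨b, hb, rfl⟩ := Polynomial.isUnit_iff.1 ha
  have key : G.map (evalRingHom s0) = X ^ i * C b := by
    apply Polynomial.eq_of_infinite_eval_eq
    apply Set.Infinite.mono (s := {0}ᶜ)
    · intro z hz
      have hz : z ≠ 0 := hz
      rw [Set.mem_ofPred_eq, ← theta_eval G s0 z hz, ← hu, ← hau]
      simp
    · exact (Set.finite_singleton 0).infinite_compl
  have hnd : (G.map (evalRingHom s0)).natDegree = G.natDegree := hG.natDegree_map _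
  have hb0 : b ≠ 0 := hb.ne_zero
  rw [key, natDegree_mul_C hb0, natDegree_X_pow] at hnd
  rw [← hnd]
  by_contra hi0
  apply hs
  rw [← hGK, Polynomial.map_mul, key]
  simp [hi0]

lemma H_irreducible (H Φ : ℂ[X][X]) (k : ℂ) (hk : k ≠ 0) (hΦ : Irreducible Φ) (hm : H.Monic)
    (h1 : H ≠ 1)
    (hH : theta H = C (C k) * X ^ 4 * Φ) (s0 : ℂ) (hs : (H.map (evalRingHom s0)).eval 0 ≠ 0) :
    Irreducible H := by
  rw [hm.irreducible_iff_natDegree]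
  refine ⟨h1, fun F G hF hG h => ?_⟩
  have hd : Φ ∣ theta F * theta G := by
    rw [← map_mul, h, hH]; exact dvd_mul_left _ _
  rcases hΦ.prime.dvd_or_dvd hd with hd | hd
  · exact Or.inr (aux_unit H Φ G F k hk hΦ hH s0 hs hG h hd)
  · exact Or.inl (aux_unit H Φ F G k hk hΦ hH s0 hs hF (by rw [mul_comm, h]) hd)

/-- `p(r)`. -/
noncomputable def pp : ℂ[X] :=
  C (-38320128/107) + C (80453952/107) * X + C (-14131332/1369) * X ^ 2
   + C (12648627/214) * X ^ 3 + C (-2736821/856) * X ^ 4 + C (6196/107) * X ^ 5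

/-- `q(r)`. -/
noncomputable def qq : ℂ[X] :=
  C (3811059/214) + C (-1778227/856) * X + C (6089/107) * X ^ 2

lemma ppqq_coprime : IsCoprime pp qq := by
  refine ⟨C (52223423988825916543934438562096033944201/2023471361598719835127363048107019128281293209600) + C (-232399001029441279746860392348055154763/252933920199839979390920381013377391035161651200) * X,
   C (1036900737260632787374481498319617065127/18296724551493054064736717376546396920946300) + C (9665076761391305495267947064320601081473/1756485556943333190214724868148454104410844800) * X + C (1606679912742358884158221222394509747597/3122640990121481227048399765597251741174835200) * X ^ 2 + C (-17707031453248383779307536828428521300419/404694272319743967025472609621403825656258641920) * X ^ 3 + C (59120718113746845512873501025971002583/63233480049959994847730095253344347758790412800) * X ^ 4, ?_⟩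
  apply Polynomial.funext
  intro t
  simp only [pp, qq, eval_add, eval_mul, eval_C, eval_X, eval_pow, eval_one]
  ring

lemma Phi_pq_irreducible : Irreducible (Phi pp qq) := by
  have hdeg : qq.degree ≠ 0 := by
    have : qq.degree = 2 := by unfold qq; compute_degree!
    rw [this]; norm_num
  obtain ⟨r0, hr⟩ := IsAlgClosed.exists_root qq hdeg
  have hr' : qq.eval r0 = 0 := hr
  have hr2 := hr'
  simp only [qq, eval_add, eval_mul, eval_C, eval_X, eval_pow] at hr2
  refine Phi_irreducible pp qq r0 (C (6089/107) * X + C (-1778227/856 + 6089/107 * r0)) ?_ ?_ ?_ ?_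
    ppqq_coprime ?_ ?_
  · apply Polynomial.funext
    intro t
    simp only [qq, eval_add, eval_sub, eval_mul, eval_C, eval_X, eval_pow]
    linear_combination hr2
  · simp only [eval_add, eval_mul, eval_C, eval_X]
    intro h
    have h3 : r0 = 1778227 / (2 * 48712) := by linear_combination (107 / (2 * 6089)) * h
    rw [h3] at hr2
    norm_num at hr2
  · rintro rfl
    norm_num at hr2
  · intro hp
    obtain ⟨a, b, hab⟩ := ppqq_coprime
    have := congrArg (eval r0) hab
    simp [hp, hr'] at this
  · simp [pp]
  · have : pp - X ^ 3 * qq = C (-38320128/107) + C (80453952/107) * X + C (-14131332/1369) * X ^ 2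
      + C (4418784/107) * X ^ 3 + C (-479297/428) * X ^ 4 + X ^ 5 := by
      apply Polynomial.funext
      intro t
      simp only [pp, qq, eval_add, eval_sub, eval_mul, eval_C, eval_X, eval_pow]
      ring
    rw [this]
    compute_degree!

/-- `f₃` after the specialisation. -/
noncomputable def ww : ℂ[X] := C 10 * X ^ 3 + C (1/2) * (1 + X ^ 6)

noncomputable def cc : ℂ := -107/38320128

/-- General shape, with `R, w` for `f₂, f₃`. -/
noncomputable def HH {S : Type} [CommRing S] [Algebra ℂ S] (R w : S) : S[X] :=
  X ^ 10 + C (algebraMap ℂ S (cc * (80453952/107)) * R) * X ^ 8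
   + C (algebraMap ℂ S (cc * (-42393996/4107)) * R ^ 2) * X ^ 6
   + C (algebraMap ℂ S (cc * (50759217/214)) * R ^ 3 - algebraMap ℂ S (cc * (3811059/214)) * w) * X ^ 4
   + C (algebraMap ℂ S (cc * (-20519091/856)) * R ^ 4
      + algebraMap ℂ S (cc * (1778227/856)) * (R * w)) * X ^ 2
   + C (algebraMap ℂ S (cc * (67086/107)) * R ^ 5 - algebraMap ℂ S (cc * (6089/107)) * (R ^ 2 * w))

lemma HH_monic {S : Type} [CommRing S] [Nontrivial S] [Algebra ℂ S] (R w : S) :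
    (HH R w).Monic := by
  unfold HH
  monicity!

lemma HH_natDegree {S : Type} [CommRing S] [Nontrivial S] [Algebra ℂ S] (R w : S) :
    (HH R w).natDegree = 10 := by
  unfold HH
  compute_degree!

lemma HH_map {S T : Type} [CommRing S] [Algebra ℂ S] [CommRing T] [Algebra ℂ T] (f : S →ₐ[ℂ] T)
    (R w : S) : (HH R w).map (f : S →+* T) = HH (f R) (f w) := by
  simp [HH, -map_div₀, -map_neg, -algebraMap_eq]

lemma HH_theta : theta (HH X ww) = C (C (-cc/2)) * X ^ 4 * Phi pp qq := by
  have hinj : ∀ A B : ℂ[X][X], (∀ r z : ℂ, (A.map (evalRingHom r)).eval z = (B.map (evalRingHom r)).eval z) → A = B := by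
    intro A B h
    ext1 n
    apply Polynomial.funext
    intro r
    have := Polynomial.funext (h r)
    simpa using congrArg (fun p => p.coeff n) this
  apply hinj
  intro r z
  have t1 : theta (C X) = C X * X ^ 2 := by simp [theta]
  have t2 : theta X = X := by simp [theta]
  have t3 : ∀ a : ℂ, theta (C (C a)) = C (C a) := by intro a; simp [theta]
  have e1 : ∀ a : ℂ, algebraMap ℂ ℂ[X] a = C a := fun _ => rfl
  simp only [HH, ww, Phi, pp, qq, e1, map_add, map_sub, map_mul, map_pow, map_one, t1, t2, t3]
  simp only [Polynomial.map_add, Polynomial.map_sub, Polynomial.map_mul, Polynomial.map_pow,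
    Polynomial.map_X, Polynomial.map_C, Polynomial.map_one, coe_evalRingHom, eval_add, eval_sub, eval_mul,
    eval_pow, eval_X, eval_C, eval_one, cc]
  simp only [eval_ofNat]
  ring

lemma HH_irreducible : Irreducible (HH (X : ℂ[X]) ww) := by
  refine H_irreducible _ (Phi pp qq) (-cc/2) (by norm_num [cc]) Phi_pq_irreducible (HH_monic _ _) ?_
    HH_theta 1 ?_
  · intro h
    have := HH_natDegree (X : ℂ[X]) ww
    rw [h] at this; simp at this
  · simp [HH, ww, cc]
    norm_num

end Polynomial

lemma EΔ_eq : (((renameEquiv ℂ (Equiv.swap (0 : Fin 3) 2)).trans (finSuccEquiv ℂ 2)) Δpoly) *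
     Polynomial.C (MvPolynomial.C Polynomial.cc) =
    Polynomial.HH (S := MvPolynomial (Fin 2) ℂ) (X 1 ^ 2 + X 0 ^ 2)
     (C 11 * X 1 ^ 6 + C 15 * X 1 ^ 4 * X 0 ^ 2 + C 45 * X 1 ^ 2 * X 0 ^ 4 + C 9 * X 0 ^ 6) := by
  have h0 : (finSuccEquiv ℂ 2) (X 2) = Polynomial.C (X 1) := finSuccEquiv_X_succ (j := 1)
  have h1 : (finSuccEquiv ℂ 2) (X 1) = Polynomial.C (X 0) := finSuccEquiv_X_succ (j := 0)
  have hs : (Equiv.swap (0 : Fin 3) 2) 1 = 1 := by decide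
  have hC : ∀ a : ℂ, (finSuccEquiv ℂ 2) (C a) = Polynomial.C (C a) := by
    intro a; simp [finSuccEquiv_apply]
  have hc : Polynomial.C (C (38320128/107 : ℂ)) * Polynomial.C (C Polynomial.cc)
      = (-1 : Polynomial (MvPolynomial (Fin 2) ℂ)) := by
    rw [← Polynomial.C_mul, ← C_mul]; norm_num [Polynomial.cc]
  simp only [Δpoly, f1, f2, f3, AlgEquiv.trans_apply, renameEquiv_apply, map_add, map_sub, map_mul,
    map_neg, map_pow, rename_X, rename_C, Equiv.swap_apply_left, Equiv.swap_apply_right, hs, h0, h1,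
    finSuccEquiv_X_zero, hC, Polynomial.HH, MvPolynomial.algebraMap_eq, neg_div]
  linear_combination (-Polynomial.X ^ 10) * hc

/-- The degree-10 form `Δ` is irreducible in `ℂ[x,y,z]`; in particular the plane curve of
degree 10 it defines is irreducible. -/
theorem stmt17 : Irreducible Δpoly := by
  rw [← MulEquiv.irreducible_iff ((renameEquiv ℂ (Equiv.swap (0 : Fin 3) 2)).trans (finSuccEquiv ℂ 2))]
  have hu : IsUnit (Polynomial.C (MvPolynomial.C (σ := Fin 2) Polynomial.cc)) :=
    ((isUnit_iff_ne_zero.2 (by norm_num [Polynomial.cc])).map MvPolynomial.C).map Polynomial.C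
  rw [← irreducible_mul_isUnit hu, EΔ_eq]
  let σ : MvPolynomial (Fin 2) ℂ →ₐ[ℂ] Polynomial ℂ :=
    aeval ![Polynomial.C (-Complex.I/2) * (1 - Polynomial.X), Polynomial.C (1/2) * (1 + Polynomial.X)]
  apply Polynomial.Monic.irreducible_of_irreducible_map (σ : MvPolynomial (Fin 2) ℂ →+* Polynomial ℂ) _ (Polynomial.HH_monic _ _)
  rw [Polynomial.HH_map]
  have hI : Complex.I ^ 2 = -1 := Complex.I_sq
  have hI4 : Complex.I ^ 4 = 1 := Complex.I_pow_four
  have hI6 : Complex.I ^ 6 = -1 := by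
    rw [show (6:ℕ) = 4 + 2 by norm_num, pow_add, hI4, hI]; norm_num
  convert Polynomial.HH_irreducible using 2
  · apply Polynomial.funext
    intro t
    simp [σ, -map_div₀]
    ring_nf
    rw [hI]; ring
  · apply Polynomial.funext
    intro t
    simp [σ, Polynomial.ww, -map_div₀]
    ring_nf
    rw [hI, hI4, hI6]; ring
end
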